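/- arXiv:1810.05395 — 8 statements merged into one kernel-verified Lean document; each statement's English description precedes it below -/
import Mathlib

section
/- If φ is a downward closed propositional team formula, then φ ⊨ φ[p|⊤] ⊗ φ[p|⊥], i.e. every team satisfying φ satisfies φ[p|⊤] ⊗ φ[p|⊥]. -/
/-- Propositional team formulas: literals `p`, `¬p`, the constants `⊤`, `⊥`,
conjunction `∧` and team disjunction `⊗`. -/
inductive PForm (V : Type) : Type where
  | top : PForm V
  | var : V → PForm V
  | nvar : V → PForm V
  | bot : PForm V
  | and : PForm V → PForm V → PForm V
  | tens : PForm V → PForm V → PForm V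

namespace PForm

variable {V : Type} [DecidableEq V]

/-- Team semantics for propositional team formulas.  A team is a set of
valuations `s : V → Bool`. -/
def sat : Set (V → Bool) → PForm V → Prop
  | _, top => True
  | X, var p => ∀ s ∈ X, s p = true
  | X, nvar p => ∀ s ∈ X, s p = false
  | X, bot => X = ∅
  | X, and φ ψ => sat X φ ∧ sat X ψ
  | X, tens φ ψ => ∃ X₁ X₂, X = X₁ ∪ X₂ ∧ sat X₁ φ ∧ sat X₂ ψ

/-- The set `L(φ)` of propositional letters occurring in `φ`. -/
def letters : PForm V → Set V
  | top => ∅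
  | var p => {p}
  | nvar p => {p}
  | bot => ∅
  | and φ ψ => letters φ ∪ letters ψ
  | tens φ ψ => letters φ ∪ letters ψ

/-- Syntactic substitution `φ[p|⊤]`: the literal `p` is replaced by `⊤`,
the literal `¬p` by `⊥`, commuting with all connectives. -/
def substTop (p : V) : PForm V → PForm V
  | top => top
  | var q => if q = p then top else var q
  | nvar q => if q = p then bot else nvar q
  | bot => bot
  | and φ ψ => and (substTop p φ) (substTop p ψ)
  | tens φ ψ => tens (substTop p φ) (substTop p ψ)

/-- Syntactic substitution `φ[p|⊥]`: the literal `p` is replaced by `⊥`,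
the literal `¬p` by `⊤`, commuting with all connectives. -/
def substBot (p : V) : PForm V → PForm V
  | top => top
  | var q => if q = p then bot else var q
  | nvar q => if q = p then top else nvar q
  | bot => bot
  | and φ ψ => and (substBot p φ) (substBot p ψ)
  | tens φ ψ => tens (substBot p φ) (substBot p ψ)

/-- Team substitution `X[p|b]`: update every valuation of `X` at `p` to `b`. -/
def teamSubst (X : Set (V → Bool)) (p : V) (b : Bool) : Set (V → Bool) :=
  (fun s => Function.update s p b) '' X

/-- On a team where `p` is constantly true, `φ` entails `φ[p|⊤]`. -/
theorem sat_substTop {p : V} {φ : PForm V} {X : Set (V → Bool)}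
    (hp : ∀ s ∈ X, s p = true) (h : sat X φ) : sat X (substTop p φ) := by
  induction φ generalizing X with
  | top | bot => exact h
  | var q =>
    by_cases hq : q = p
    · simp [substTop, hq, sat]
    · simpa [substTop, hq] using h
  | nvar q =>
    by_cases hq : q = p
    · subst hq
      simp only [substTop, if_true, sat, Set.eq_empty_iff_forall_notMem]
      exact fun s hs => Bool.false_ne_true ((h s hs).symm.trans (hp s hs))
    · simpa [substTop, hq] using h
  | and φ ψ ihφ ihψ => exact ⟨ihφ hp h.1, ihψ hp h.2⟩
  | tens φ ψ ihφ ihψ =>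
    obtain ⟨Y, Z, rfl, hY, hZ⟩ := h
    exact ⟨Y, Z, rfl, ihφ (fun s hs => hp s (.inl hs)) hY, ihψ (fun s hs => hp s (.inr hs)) hZ⟩

/-- On a team where `p` is constantly false, `φ` entails `φ[p|⊥]`. -/
theorem sat_substBot {p : V} {φ : PForm V} {X : Set (V → Bool)}
    (hp : ∀ s ∈ X, s p = false) (h : sat X φ) : sat X (substBot p φ) := by
  induction φ generalizing X with
  | top | bot => exact h
  | var q =>
    by_cases hq : q = p
    · subst hq
      simp only [substBot, if_true, sat, Set.eq_empty_iff_forall_notMem]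
      exact fun s hs => Bool.false_ne_true ((hp s hs).symm.trans (h s hs))
    · simpa [substBot, hq] using h
  | nvar q =>
    by_cases hq : q = p
    · simp [substBot, hq, sat]
    · simpa [substBot, hq] using h
  | and φ ψ ihφ ihψ => exact ⟨ihφ hp h.1, ihψ hp h.2⟩
  | tens φ ψ ihφ ihψ =>
    obtain ⟨Y, Z, rfl, hY, hZ⟩ := h
    exact ⟨Y, Z, rfl, ihφ (fun s hs => hp s (.inl hs)) hY, ihψ (fun s hs => hp s (.inr hs)) hZ⟩

end PForm

open PForm in
/-- if `φ` is downward closed then `φ ⊨ φ[p|⊤] ⊗ φ[p|⊥]`. -/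
theorem downward_closed_subst {V : Type} [DecidableEq V] (φ : PForm V) (p : V)
    (hdc : ∀ X Y : Set (V → Bool), sat X φ → Y ⊆ X → sat Y φ) :
    ∀ X : Set (V → Bool), sat X φ → sat X (tens (substTop p φ) (substBot p φ)) := by
  intro X hX
  refine ⟨{s ∈ X | s p = true}, {s ∈ X | s p = false}, ?_,
    sat_substTop (fun s hs => hs.2) (hdc X _ hX (Set.sep_subset _ _)),
    sat_substBot (fun s hs => hs.2) (hdc X _ hX (Set.sep_subset _ _))⟩
  ext s
  cases hs : s p <;> simp [hs]
end

section
/- Suppose φ is a union closed propositional team formula, ψ is a local propositional team formula, φ ⊨ ψ, and p ∉ L(ψ). Then φ[p|⊤] ⊗ φ[p|⊥] ⊨ ψ. -/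
namespace PForm

/-- `Y =_L X`: every valuation of `Y` agrees on the letters of `L` with some
valuation of `X`, and conversely. -/
def eqOn (L : Set V) (X Y : Set (V → Bool)) : Prop :=
  (∀ s ∈ Y, ∃ s' ∈ X, ∀ q ∈ L, s q = s' q) ∧
  (∀ s ∈ X, ∃ s' ∈ Y, ∀ q ∈ L, s q = s' q)

end PForm

namespace PForm

theorem sat_teamSubst_of_sat_substTop {V : Type} [DecidableEq V] (p : V) (φ : PForm V)
    (X : Set (V → Bool)) (h : sat X (substTop p φ)) : sat (teamSubst X p true) φ := by
  induction φ generalizing X with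
  | top => trivial
  | var q | nvar q =>
    rintro _ ⟨s, hs, rfl⟩
    by_cases hq : q = p <;> simp_all [substTop, sat]
  | bot => simp_all [substTop, sat, teamSubst]
  | and φ ψ ihφ ihψ => exact ⟨ihφ X h.1, ihψ X h.2⟩
  | tens φ ψ ihφ ihψ =>
    obtain ⟨X₁, X₂, rfl, h₁, h₂⟩ := h
    exact ⟨_, _, Set.image_union _ _ _, ihφ X₁ h₁, ihψ X₂ h₂⟩

theorem sat_teamSubst_of_sat_substBot {V : Type} [DecidableEq V] (p : V) (φ : PForm V)
    (X : Set (V → Bool)) (h : sat X (substBot p φ)) : sat (teamSubst X p false) φ := by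
  induction φ generalizing X with
  | top => trivial
  | var q | nvar q =>
    rintro _ ⟨s, hs, rfl⟩
    by_cases hq : q = p <;> simp_all [substBot, sat]
  | bot => simp_all [substBot, sat, teamSubst]
  | and φ ψ ihφ ihψ => exact ⟨ihφ X h.1, ihψ X h.2⟩
  | tens φ ψ ihφ ihψ =>
    obtain ⟨X₁, X₂, rfl, h₁, h₂⟩ := h
    exact ⟨_, _, Set.image_union _ _ _, ihφ X₁ h₁, ihψ X₂ h₂⟩

theorem eqOn_teamSubst {V : Type} [DecidableEq V] {L : Set V} {p : V} (hp : p ∉ L)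
    (X : Set (V → Bool)) (b : Bool) : eqOn L (teamSubst X p b) X := by
  have update_eq (s : V → Bool) : ∀ q ∈ L, Function.update s p b q = s q := fun q hq =>
    Function.update_of_ne (ne_of_mem_of_not_mem hq hp) b s
  constructor
  · exact fun s hs => ⟨_, ⟨s, hs, rfl⟩, fun q hq => (update_eq s q hq).symm⟩
  · rintro _ ⟨s, hs, rfl⟩
    exact ⟨s, hs, update_eq s⟩

theorem eqOn.union {V : Type} {L : Set V} {X₁ X₂ Y₁ Y₂ : Set (V → Bool)}
    (h₁ : eqOn L X₁ Y₁) (h₂ : eqOn L X₂ Y₂) : eqOn L (X₁ ∪ X₂) (Y₁ ∪ Y₂) := by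
  constructor
  · rintro s (hs | hs)
    · exact (h₁.1 s hs).imp fun _ h => ⟨Or.inl h.1, h.2⟩
    · exact (h₂.1 s hs).imp fun _ h => ⟨Or.inr h.1, h.2⟩
  · rintro s (hs | hs)
    · exact (h₁.2 s hs).imp fun _ h => ⟨Or.inl h.1, h.2⟩
    · exact (h₂.2 s hs).imp fun _ h => ⟨Or.inr h.1, h.2⟩

end PForm

open PForm in
/-- if `φ` is union closed, `ψ` is local, `φ ⊨ ψ` and
`p ∉ L(ψ)`, then `φ[p|⊤] ⊗ φ[p|⊥] ⊨ ψ`. -/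
theorem union_closed_subst {V : Type} [DecidableEq V] (φ ψ : PForm V) (p : V)
    (huc : ∀ X₁ X₂ : Set (V → Bool), sat X₁ φ → sat X₂ φ → sat (X₁ ∪ X₂) φ)
    (hloc : ∀ X Y : Set (V → Bool), sat X ψ → eqOn (letters ψ) X Y → sat Y ψ)
    (hcons : ∀ X : Set (V → Bool), sat X φ → sat X ψ)
    (hp : p ∉ letters ψ) :
    ∀ X : Set (V → Bool), sat X (tens (substTop p φ) (substBot p φ)) → sat X ψ := by
  rintro _ ⟨X₁, X₂, rfl, h₁, h₂⟩
  exact hloc _ _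
    (hcons _ (huc _ _ (sat_teamSubst_of_sat_substTop p φ X₁ h₁)
      (sat_teamSubst_of_sat_substBot p φ X₂ h₂)))
    ((eqOn_teamSubst hp X₁ true).union (eqOn_teamSubst hp X₂ false))
end

section
/- Classical Propositional Team Logic CPL enjoys uniform interpolation: for every CPL formula φ and propositional letter p, the formula φ[p|⊤] ⊗ φ[p|⊥] is a uniform interpolant of φ with respect to L(φ)∖{p}, and by iterating this construction a uniform interpolant of φ with respect to any subset of L(φ) exists in CPL. -/
namespace PForm

/-- `θ` is a uniform interpolant of `φ` with respect to `L' ⊆ L(φ)`: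
`L(θ) ⊆ L'`, `φ ⊨ θ`, and `θ ⊨ ψ` whenever `φ ⊨ ψ` and `L(φ) ∩ L(ψ) ⊆ L'`. -/
def UnifInterp (φ θ : PForm V) (L' : Set V) : Prop :=
  letters θ ⊆ L' ∧
  (∀ X, sat X φ → sat X θ) ∧
  (∀ ψ : PForm V, (∀ X, sat X φ → sat X ψ) → letters φ ∩ letters ψ ⊆ L' →
    ∀ X, sat X θ → sat X ψ)

end PForm

namespace PForm

/-- Satisfaction of a formula at a single valuation. -/
def holdsAt {V : Type} (s : V → Bool) : PForm V → Prop
  | top => True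
  | var p => s p = true
  | nvar p => s p = false
  | bot => False
  | and φ ψ => holdsAt s φ ∧ holdsAt s ψ
  | tens φ ψ => holdsAt s φ ∨ holdsAt s ψ

/-- Formulas are flat: a team satisfies `φ` iff each of its valuations does. -/
theorem sat_iff_forall_holdsAt {V : Type} (φ : PForm V) (X : Set (V → Bool)) :
    sat X φ ↔ ∀ s ∈ X, holdsAt s φ := by
  induction φ generalizing X with
  | top => simp [sat, holdsAt]
  | var p => simp [sat, holdsAt]
  | nvar p => simp [sat, holdsAt]
  | bot => simp [sat, holdsAt, Set.eq_empty_iff_forall_notMem]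
  | and φ ψ ihφ ihψ => simp only [sat, holdsAt, ihφ, ihψ, forall_and]
  | tens φ ψ ihφ ihψ =>
    simp only [sat, holdsAt, ihφ, ihψ]
    constructor
    · rintro ⟨X₁, X₂, rfl, h₁, h₂⟩ s (hs | hs)
      · exact Or.inl (h₁ s hs)
      · exact Or.inr (h₂ s hs)
    · intro h
      refine ⟨{s ∈ X | holdsAt s φ}, {s ∈ X | holdsAt s ψ}, ?_,
        fun s hs => hs.2, fun s hs => hs.2⟩
      ext s
      simp only [Set.mem_union, Set.mem_ofPred_eq, ← and_or_left]
      exact ⟨fun hs => ⟨hs, h s hs⟩, fun hs => hs.1⟩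

theorem forall_sat_imp_iff {V : Type} (φ ψ : PForm V) :
    (∀ X, sat X φ → sat X ψ) ↔ ∀ s, holdsAt s φ → holdsAt s ψ := by
  simp only [sat_iff_forall_holdsAt]
  exact ⟨fun h s hs => h {s} (by simpa using hs) s rfl, fun h X hX s hs => h s (hX s hs)⟩

theorem holdsAt_congr {V : Type} {s t : V → Bool} (φ : PForm V)
    (h : ∀ q ∈ letters φ, s q = t q) : holdsAt s φ ↔ holdsAt t φ := by
  induction φ <;> simp_all [holdsAt, letters, or_imp, forall_and]

theorem holdsAt_update_of_notMem {V : Type} [DecidableEq V] {s : V → Bool} {p : V} {b : Bool}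
    {φ : PForm V} (hp : p ∉ letters φ) : holdsAt (Function.update s p b) φ ↔ holdsAt s φ :=
  holdsAt_congr φ fun _ hq => Function.update_of_ne (ne_of_mem_of_not_mem hq hp) _ _

theorem holdsAt_substTop {V : Type} [DecidableEq V] (s : V → Bool) (p : V) (φ : PForm V) :
    holdsAt s (substTop p φ) ↔ holdsAt (Function.update s p true) φ := by
  induction φ <;> simp_all only [substTop, holdsAt] <;> split_ifs <;> simp_all [holdsAt]

theorem holdsAt_substBot {V : Type} [DecidableEq V] (s : V → Bool) (p : V) (φ : PForm V) :
    holdsAt s (substBot p φ) ↔ holdsAt (Function.update s p false) φ := by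
  induction φ <;> simp_all only [substBot, holdsAt] <;> split_ifs <;> simp_all [holdsAt]

theorem letters_substTop_subset {V : Type} [DecidableEq V] (p : V) (φ : PForm V) :
    letters (substTop p φ) ⊆ letters φ \ {p} := by
  induction φ <;> simp only [substTop] <;> (try split_ifs) <;>
    simp_all only [letters, Set.subset_def, Set.mem_sdiff, Set.mem_union, Set.mem_singleton_iff,
      Set.mem_empty_iff_false] <;> grind

theorem letters_substBot_subset {V : Type} [DecidableEq V] (p : V) (φ : PForm V) :
    letters (substBot p φ) ⊆ letters φ \ {p} := by
  induction φ <;> simp only [substBot] <;> (try split_ifs) <;>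
    simp_all only [letters, Set.subset_def, Set.mem_sdiff, Set.mem_union, Set.mem_singleton_iff,
      Set.mem_empty_iff_false] <;> grind

theorem letters_finite {V : Type} (φ : PForm V) : (letters φ).Finite := by
  induction φ <;> simp_all [letters]

theorem unifInterp_tens_subst {V : Type} [DecidableEq V] (φ : PForm V) (p : V) :
    UnifInterp φ (tens (substTop p φ) (substBot p φ)) (letters φ \ {p}) := by
  refine ⟨Set.union_subset (letters_substTop_subset p φ) (letters_substBot_subset p φ), ?_, ?_⟩
  · rw [forall_sat_imp_iff]
    intro s hs
    simp only [holdsAt, holdsAt_substTop, holdsAt_substBot]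
    rw [← Function.update_eq_self p s] at hs
    cases h : s p <;> rw [h] at hs
    · exact Or.inr hs
    · exact Or.inl hs
  · intro ψ hψ hL
    rw [forall_sat_imp_iff] at hψ ⊢
    have key : ∀ (s : V → Bool) (b : Bool), holdsAt (Function.update s p b) φ → holdsAt s ψ := by
      intro s b hs
      by_cases hp : p ∈ letters ψ
      · exact hψ s ((holdsAt_update_of_notMem fun hp' => (hL ⟨hp', hp⟩).2 rfl).1 hs)
      · exact (holdsAt_update_of_notMem hp).1 (hψ _ hs)
    intro s hs
    simp only [holdsAt, holdsAt_substTop, holdsAt_substBot] at hs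
    exact hs.elim (key s true) (key s false)

theorem exists_unifInterp_diff {V : Type} [DecidableEq V] (φ : PForm V) (S : Finset V) :
    ∃ θ : PForm V, UnifInterp φ θ (letters φ \ S) := by
  induction S using Finset.induction_on with
  | empty =>
    exact ⟨φ, by simp, fun _ h => h, fun _ h _ => h⟩
  | insert a S _ ih =>
    obtain ⟨θ, hθL, hφθ, hθ⟩ := ih
    obtain ⟨hχL, hθχ, hχ⟩ := unifInterp_tens_subst θ a
    refine ⟨_, hχL.trans fun q hq => ?_, fun X h => hθχ X (hφθ X h), fun ψ hψ hL => ?_⟩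
    · have := hθL hq.1
      simp_all
    · refine hχ ψ (hθ ψ hψ fun q hq => ?_) fun q hq => ⟨hq.1, ?_⟩
      · have := hL hq
        simp_all
      · have := hL ⟨(hθL hq.1).1, hq.2⟩
        simp_all

end PForm

open PForm in
/-- Classical Propositional Team Logic enjoys uniform
interpolation: `φ[p|⊤] ⊗ φ[p|⊥]` is a uniform interpolant of `φ` w.r.t.
`L(φ) \ {p}`, and for every `L' ⊆ L(φ)` there exists a uniform interpolant
of `φ` w.r.t. `L'`. -/
theorem cpl_uniform_interpolation {V : Type} [DecidableEq V] (φ : PForm V) :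
    (∀ p : V, UnifInterp φ (tens (substTop p φ) (substBot p φ)) (letters φ \ {p})) ∧
    (∀ L' : Set V, L' ⊆ letters φ → ∃ θ : PForm V, UnifInterp φ θ L') := by
  refine ⟨unifInterp_tens_subst φ, fun L' hL' => ?_⟩
  have h := exists_unifInterp_diff φ ((letters_finite φ).subset
    (Set.sdiff_subset (t := L'))).toFinset
  rwa [Set.Finite.coe_toFinset, Set.sdiff_sdiff_cancel_left hL'] at h
end

section
/- For the Propositional Dependence Logic formula φ(p,q) := =(p,q) ∧ =(p): the formula φ[p|⊤] ⊗ φ[p|⊥] is satisfied by every team; φ ⊨ =(q); but =(q) is not satisfied by every team. Consequently φ[p|⊤] ⊗ φ[p|⊥] is not a uniform interpolant of φ with respect to L(φ)∖{p}. -/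
/-- Classical propositional formulas (the arguments of dependence atoms). -/
inductive CForm (V : Type) : Type where
  | top : CForm V
  | bot : CForm V
  | var : V → CForm V
  | nvar : V → CForm V
  | and : CForm V → CForm V → CForm V
  | or : CForm V → CForm V → CForm V

namespace CForm

variable {V : Type} [DecidableEq V]

/-- Classical (single-valuation) boolean semantics. -/
def eval (s : V → Bool) : CForm V → Bool
  | top => true
  | bot => false
  | var p => s p
  | nvar p => !(s p)
  | and α β => eval s α && eval s β
  | or α β => eval s α || eval s β

/-- Letters of a classical formula. -/
def letters : CForm V → Set V
  | top => ∅
  | bot => ∅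
  | var p => {p}
  | nvar p => {p}
  | and α β => letters α ∪ letters β
  | or α β => letters α ∪ letters β

/-- Substitute `⊤` for `p` (and `⊥` for `¬p`). -/
def substTop (p : V) : CForm V → CForm V
  | top => top
  | bot => bot
  | var q => if q = p then top else var q
  | nvar q => if q = p then bot else nvar q
  | and α β => and (substTop p α) (substTop p β)
  | or α β => or (substTop p α) (substTop p β)

/-- Substitute `⊥` for `p` (and `⊤` for `¬p`). -/
def substBot (p : V) : CForm V → CForm V
  | top => top
  | bot => bot
  | var q => if q = p then bot else var q
  | nvar q => if q = p then top else nvar q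
  | and α β => and (substBot p α) (substBot p β)
  | or α β => or (substBot p α) (substBot p β)

end CForm

/-- Propositional Dependence Logic formulas: literals, `⊥`, dependence atoms
`=(ᾱ, β)`, conjunction and team disjunction. -/
inductive PDForm (V : Type) : Type where
  | top : PDForm V
  | var : V → PDForm V
  | nvar : V → PDForm V
  | bot : PDForm V
  | dep : List (CForm V) → CForm V → PDForm V
  | and : PDForm V → PDForm V → PDForm V
  | tens : PDForm V → PDForm V → PDForm V

namespace PDForm

variable {V : Type} [DecidableEq V]

/-- Team semantics of Propositional Dependence Logic. -/
def sat : Set (V → Bool) → PDForm V → Prop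
  | _, top => True
  | X, var p => ∀ s ∈ X, s p = true
  | X, nvar p => ∀ s ∈ X, s p = false
  | X, bot => X = ∅
  | X, dep args t => ∀ s ∈ X, ∀ s' ∈ X,
      args.map (CForm.eval s) = args.map (CForm.eval s') →
        CForm.eval s t = CForm.eval s' t
  | X, and φ ψ => sat X φ ∧ sat X ψ
  | X, tens φ ψ => ∃ X₁ X₂, X = X₁ ∪ X₂ ∧ sat X₁ φ ∧ sat X₂ ψ

/-- Letters of a `PDForm`. -/
def letters : PDForm V → Set V
  | top => ∅
  | var p => {p}
  | nvar p => {p}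
  | bot => ∅
  | dep args t => (⋃ α ∈ args, CForm.letters α) ∪ CForm.letters t
  | and φ ψ => letters φ ∪ letters ψ
  | tens φ ψ => letters φ ∪ letters ψ

/-- Syntactic substitution `φ[p|⊤]` (acting inside atoms as well). -/
def substTop (p : V) : PDForm V → PDForm V
  | top => top
  | var q => if q = p then top else var q
  | nvar q => if q = p then bot else nvar q
  | bot => bot
  | dep args t => dep (args.map (CForm.substTop p)) (CForm.substTop p t)
  | and φ ψ => and (substTop p φ) (substTop p ψ)
  | tens φ ψ => tens (substTop p φ) (substTop p ψ)

/-- Syntactic substitution `φ[p|⊥]` (acting inside atoms as well). -/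
def substBot (p : V) : PDForm V → PDForm V
  | top => top
  | var q => if q = p then bot else var q
  | nvar q => if q = p then top else nvar q
  | bot => bot
  | dep args t => dep (args.map (CForm.substBot p)) (CForm.substBot p t)
  | and φ ψ => and (substBot p φ) (substBot p ψ)
  | tens φ ψ => tens (substBot p φ) (substBot p ψ)

/-- `θ` is a uniform interpolant of `φ` with respect to `L'`. -/
def UnifInterp (φ θ : PDForm V) (L' : Set V) : Prop :=
  letters θ ⊆ L' ∧
  (∀ X, sat X φ → sat X θ) ∧
  (∀ ψ : PDForm V, (∀ X, sat X φ → sat X ψ) → letters φ ∩ letters ψ ⊆ L' →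
    ∀ X, sat X θ → sat X ψ)

end PDForm

open PDForm

/-- The example formula `φ(p,q) := =(p,q) ∧ =(p)` with `p := 0`, `q := 1`. -/
def φdep : PDForm ℕ := .and (.dep [.var 0] (.var 1)) (.dep [] (.var 0))

/-- The disjunction `φ[p|⊤] ⊗ φ[p|⊥]` is valid: split a team by the value of `q`. -/
theorem sat_tens_subst_φdep (X : Set (ℕ → Bool)) :
    sat X (.tens (substTop 0 φdep) (substBot 0 φdep)) := by
  refine ⟨{s ∈ X | s 1 = true}, {s ∈ X | s 1 = false}, ?_, ?_, ?_⟩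
  · ext s
    cases h : s 1 <;> simp [h]
  · simp +contextual [φdep, substTop, sat, CForm.substTop, CForm.eval]
  · simp +contextual [φdep, substBot, sat, CForm.substBot, CForm.eval]

/-- `φ ⊨ =(q)`. -/
theorem sat_const_of_sat_φdep (X : Set (ℕ → Bool)) (h : sat X φdep) :
    sat X (.dep [] (.var 1)) := by
  intro s hs s' hs' _
  have hp : s 0 = s' 0 := h.2 s hs s' hs' rfl
  exact h.1 s hs s' hs' (by simp [CForm.eval, hp])

/-- The full team does not satisfy a constancy atom. -/
theorem not_forall_sat_const :
    ¬ ∀ X : Set (ℕ → Bool), sat X (.dep [] (.var 1)) := by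
  intro h
  have := h Set.univ (fun _ => true) trivial (fun _ => false) trivial rfl
  simp [CForm.eval] at this

/-- `φ[p|⊤] ⊗ φ[p|⊥]` is satisfied by every team; `φ ⊨ =(q)`;
but `=(q)` is not satisfied by every team.  Consequently `φ[p|⊤] ⊗ φ[p|⊥]`
is not a uniform interpolant of `φ` with respect to `L(φ) \ {p}`. -/
theorem dep_counterexample :
    (∀ X : Set (ℕ → Bool), sat X (.tens (substTop 0 φdep) (substBot 0 φdep))) ∧
    (∀ X : Set (ℕ → Bool), sat X φdep → sat X (.dep [] (.var 1))) ∧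
    ¬ (∀ X : Set (ℕ → Bool), sat X (.dep [] (.var 1))) ∧
    ¬ UnifInterp φdep (.tens (substTop 0 φdep) (substBot 0 φdep)) (letters φdep \ {0}) := by
  refine ⟨sat_tens_subst_φdep, sat_const_of_sat_φdep, not_forall_sat_const, ?_⟩
  rintro ⟨-, -, h⟩
  refine not_forall_sat_const fun X =>
    h _ sat_const_of_sat_φdep ?_ X (sat_tens_subst_φdep X)
  rintro x ⟨hx, hx'⟩
  refine ⟨hx, ?_⟩
  simp only [letters, CForm.letters, List.not_mem_nil, Set.iUnion_of_empty, Set.iUnion_empty,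
    Set.empty_union, Set.mem_singleton_iff] at hx'
  simp [hx']
end

section
/- Every formula φ of Full Modal Team Logic is invariant under team bisimulation with respect to L(φ): if (M,X) ⊨ φ and (M,X) ⇌_{L(φ)} (N,Y) then (N,Y) ⊨ φ. Moreover, if φ has modal depth k, then φ is invariant under team k-bisimulation: if (M,X) ⊨ φ and (M,X) ⇌ᵏ_{L(φ)} (N,Y) then (N,Y) ⊨ φ. -/
/-- A Kripke model `M = (W, R, V)` over a set `V` of propositional letters. -/
structure KModel (V : Type) : Type 1 where
  W : Type
  R : W → W → Prop
  val : W → V → Prop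

variable {V : Type}

/-- `B` is a `P`-bisimulation between the Kripke models `M` and `N`:
related points agree on all propositions of `P`, and `B` satisfies the
forth and back conditions. -/
def IsBisim (P : Set V) (M N : KModel V) (B : M.W → N.W → Prop) : Prop :=
  (∀ w v, B w v → ∀ p ∈ P, (M.val w p ↔ N.val v p)) ∧
  (∀ w v, B w v → ∀ w', M.R w w' → ∃ v', N.R v v' ∧ B w' v') ∧
  (∀ w v, B w v → ∀ v', N.R v v' → ∃ w', M.R w w' ∧ B w' v')

/-- `(M,w) ⇌_P (N,v)`: some `P`-bisimulation relates `w` and `v`. -/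
def Bisimilar (P : Set V) (M : KModel V) (w : M.W) (N : KModel V) (v : N.W) : Prop :=
  ∃ B, IsBisim P M N B ∧ B w v

/-- Team `P`-bisimulation `(M,X) ⇌_P (N,Y)`: every point of `X` is
`P`-bisimilar to some point of `Y` and conversely. -/
def TeamBisim (P : Set V) (M : KModel V) (X : Set M.W) (N : KModel V) (Y : Set N.W) : Prop :=
  (∀ x ∈ X, ∃ y ∈ Y, Bisimilar P M x N y) ∧
  (∀ y ∈ Y, ∃ x ∈ X, Bisimilar P M x N y)

/-- Formulas of Full Modal Team Logic: literals, `⊥`, `NE`, `∧`, `⊗`, `∨`,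
`◇`, `□`. -/
inductive MForm (V : Type) : Type where
  | var : V → MForm V
  | nvar : V → MForm V
  | bot : MForm V
  | ne : MForm V
  | and : MForm V → MForm V → MForm V
  | tens : MForm V → MForm V → MForm V
  | or : MForm V → MForm V → MForm V
  | dia : MForm V → MForm V
  | box : MForm V → MForm V

/-- `R(X) = {t : ∃ s ∈ X, sRt}`. -/
def KModel.img (M : KModel V) (X : Set M.W) : Set M.W := {t | ∃ s ∈ X, M.R s t}

/-- `X R Y`: every point of `X` has an `R`-successor in `Y` and every point
of `Y` has an `R`-predecessor in `X`. -/
def teamR (M : KModel V) (X Y : Set M.W) : Prop :=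
  (∀ x ∈ X, ∃ y ∈ Y, M.R x y) ∧ (∀ y ∈ Y, ∃ x ∈ X, M.R x y)

/-- Modal team semantics of Full Modal Team Logic. -/
def MSat (M : KModel V) : Set M.W → MForm V → Prop
  | X, .var p => ∀ s ∈ X, M.val s p
  | X, .nvar p => ∀ s ∈ X, ¬ M.val s p
  | X, .bot => X = ∅
  | X, .ne => X ≠ ∅
  | X, .and φ ψ => MSat M X φ ∧ MSat M X ψ
  | X, .tens φ ψ => ∃ X₁ X₂, X = X₁ ∪ X₂ ∧ MSat M X₁ φ ∧ MSat M X₂ ψ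
  | X, .or φ ψ => MSat M X φ ∨ MSat M X ψ
  | X, .dia φ => ∃ Y, teamR M X Y ∧ MSat M Y φ
  | X, .box φ => MSat M (M.img X) φ

/-- The set `L(φ)` of propositional letters occurring in `φ` (these are
exactly the free variables of an `FMTL` formula). -/
def mletters : MForm V → Set V
  | .var p => {p}
  | .nvar p => {p}
  | .bot => ∅
  | .ne => ∅
  | .and φ ψ => mletters φ ∪ mletters ψ
  | .tens φ ψ => mletters φ ∪ mletters ψ
  | .or φ ψ => mletters φ ∪ mletters ψ
  | .dia φ => mletters φ
  | .box φ => mletters φ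

/-- `(M,w) ⇌ᵏ_P (N,v)`: bounded `P`-bisimilarity up to depth `k`. -/
def BisimilarN (P : Set V) (M N : KModel V) : ℕ → M.W → N.W → Prop
  | 0, w, v => ∀ p ∈ P, (M.val w p ↔ N.val v p)
  | k + 1, w, v =>
      (∀ p ∈ P, (M.val w p ↔ N.val v p)) ∧
      (∀ w', M.R w w' → ∃ v', N.R v v' ∧ BisimilarN P M N k w' v') ∧
      (∀ v', N.R v v' → ∃ w', M.R w w' ∧ BisimilarN P M N k w' v')

/-- Team `k`-bisimulation `(M,X) ⇌ᵏ_P (N,Y)`. -/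
def TeamBisimN (P : Set V) (k : ℕ) (M : KModel V) (X : Set M.W)
    (N : KModel V) (Y : Set N.W) : Prop :=
  (∀ x ∈ X, ∃ y ∈ Y, BisimilarN P M N k x y) ∧
  (∀ y ∈ Y, ∃ x ∈ X, BisimilarN P M N k x y)

/-- Modal depth of a formula. -/
def mdepth : MForm V → ℕ
  | .var _ => 0
  | .nvar _ => 0
  | .bot => 0
  | .ne => 0
  | .and φ ψ => max (mdepth φ) (mdepth ψ)
  | .tens φ ψ => max (mdepth φ) (mdepth ψ)
  | .or φ ψ => max (mdepth φ) (mdepth ψ)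
  | .dia φ => mdepth φ + 1
  | .box φ => mdepth φ + 1

theorem BisimilarN.val_iff {P : Set V} {M N : KModel V} {n : ℕ} {w : M.W} {v : N.W}
    (h : BisimilarN P M N n w v) {p : V} (hp : p ∈ P) : M.val w p ↔ N.val v p := by
  cases n with
  | zero => exact h p hp
  | succ n => exact h.1 p hp

theorem IsBisim.bisimilarN {P : Set V} {M N : KModel V} {B : M.W → N.W → Prop}
    (hB : IsBisim P M N B) (n : ℕ) {w : M.W} {v : N.W} (h : B w v) :
    BisimilarN P M N n w v := by
  induction n generalizing w v with
  | zero => exact hB.1 w v h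
  | succ n ih =>
    refine ⟨hB.1 w v h, fun w' hw => ?_, fun v' hv => ?_⟩
    · obtain ⟨v', hv, hb⟩ := hB.2.1 w v h w' hw
      exact ⟨v', hv, ih hb⟩
    · obtain ⟨w', hw, hb⟩ := hB.2.2 w v h v' hv
      exact ⟨w', hw, ih hb⟩

theorem TeamBisim.teamBisimN {P : Set V} {M N : KModel V} {X : Set M.W} {Y : Set N.W}
    (h : TeamBisim P M X N Y) (n : ℕ) : TeamBisimN P n M X N Y := by
  refine ⟨fun x hx => ?_, fun y hy => ?_⟩
  · obtain ⟨y, hy, B, hB, hxy⟩ := h.1 x hx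
    exact ⟨y, hy, hB.bisimilarN n hxy⟩
  · obtain ⟨x, hx, B, hB, hxy⟩ := h.2 y hy
    exact ⟨x, hx, hB.bisimilarN n hxy⟩

theorem TeamBisimN.eq_empty_iff {P : Set V} {n : ℕ} {M N : KModel V} {X : Set M.W}
    {Y : Set N.W} (h : TeamBisimN P n M X N Y) : X = ∅ ↔ Y = ∅ := by
  simp only [Set.eq_empty_iff_forall_notMem]
  refine ⟨fun hX y hy => ?_, fun hY x hx => ?_⟩
  · obtain ⟨x, hx, -⟩ := h.2 y hy
    exact hX x hx
  · obtain ⟨y, hy, -⟩ := h.1 x hx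
    exact hY y hy

/-- The points of `Y` that are `n`-bisimilar to a point of a subteam of `X` form a team
`n`-bisimilar to that subteam. -/
theorem TeamBisimN.of_subset {P : Set V} {n : ℕ} {M N : KModel V} {X X' : Set M.W}
    {Y : Set N.W} (h : TeamBisimN P n M X N Y) (hX : X' ⊆ X) :
    TeamBisimN P n M X' N {y ∈ Y | ∃ x ∈ X', BisimilarN P M N n x y} := by
  refine ⟨fun x hx => ?_, fun y hy => hy.2⟩
  obtain ⟨y, hy, hxy⟩ := h.1 x (hX hx)
  exact ⟨y, ⟨hy, x, hx, hxy⟩, hxy⟩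

theorem TeamBisimN.img {P : Set V} {n : ℕ} {M N : KModel V} {X : Set M.W} {Y : Set N.W}
    (h : TeamBisimN P (n + 1) M X N Y) : TeamBisimN P n M (M.img X) N (N.img Y) := by
  refine ⟨?_, ?_⟩
  · rintro x' ⟨x, hx, hxx'⟩
    obtain ⟨y, hy, hxy⟩ := h.1 x hx
    obtain ⟨y', hyy', hb⟩ := hxy.2.1 x' hxx'
    exact ⟨y', ⟨y, hy, hyy'⟩, hb⟩
  · rintro y' ⟨y, hy, hyy'⟩
    obtain ⟨x, hx, hxy⟩ := h.2 y hy
    obtain ⟨x', hxx', hb⟩ := hxy.2.2 y' hyy'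
    exact ⟨x', ⟨x, hx, hxx'⟩, hb⟩

theorem TeamBisimN.exists_teamR {P : Set V} {n : ℕ} {M N : KModel V} {X X' : Set M.W}
    {Y : Set N.W} (h : TeamBisimN P (n + 1) M X N Y) (hX : teamR M X X') :
    ∃ Y', teamR N Y Y' ∧ TeamBisimN P n M X' N Y' := by
  refine ⟨{y' ∈ N.img Y | ∃ x' ∈ X', BisimilarN P M N n x' y'}, ⟨fun y hy => ?_, ?_⟩,
    h.img.of_subset hX.2⟩
  · obtain ⟨x, hx, hxy⟩ := h.2 y hy
    obtain ⟨x', hx', hxx'⟩ := hX.1 x hx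
    obtain ⟨y', hyy', hb⟩ := hxy.2.1 x' hxx'
    exact ⟨y', ⟨⟨y, hy, hyy'⟩, x', hx', hb⟩, hyy'⟩
  · exact fun y' hy' => hy'.1

theorem MSat.of_teamBisimN {P : Set V} {φ : MForm V} {n : ℕ} {M N : KModel V} {X : Set M.W}
    {Y : Set N.W} (hP : mletters φ ⊆ P) (hn : mdepth φ ≤ n) (hX : MSat M X φ)
    (h : TeamBisimN P n M X N Y) : MSat N Y φ := by
  induction φ generalizing n X Y with
  | var p =>
    intro y hy
    obtain ⟨x, hx, hxy⟩ := h.2 y hy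
    exact (hxy.val_iff (hP rfl)).1 (hX x hx)
  | nvar p =>
    intro y hy
    obtain ⟨x, hx, hxy⟩ := h.2 y hy
    exact fun hv => hX x hx ((hxy.val_iff (hP rfl)).2 hv)
  | bot => exact h.eq_empty_iff.1 hX
  | ne => exact fun hY => hX (h.eq_empty_iff.2 hY)
  | and φ ψ ihφ ihψ =>
    obtain ⟨hPφ, hPψ⟩ := Set.union_subset_iff.1 hP
    obtain ⟨hnφ, hnψ⟩ := max_le_iff.1 hn
    exact ⟨ihφ hPφ hnφ hX.1 h, ihψ hPψ hnψ hX.2 h⟩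
  | tens φ ψ ihφ ihψ =>
    obtain ⟨hPφ, hPψ⟩ := Set.union_subset_iff.1 hP
    obtain ⟨hnφ, hnψ⟩ := max_le_iff.1 hn
    obtain ⟨X₁, X₂, rfl, h₁, h₂⟩ := hX
    refine ⟨_, _, ?_, ihφ hPφ hnφ h₁ (h.of_subset Set.subset_union_left),
      ihψ hPψ hnψ h₂ (h.of_subset Set.subset_union_right)⟩
    ext y
    refine ⟨fun hy => ?_, fun hy => hy.elim And.left And.left⟩
    obtain ⟨x, hx | hx, hxy⟩ := h.2 y hy
    · exact Or.inl ⟨hy, x, hx, hxy⟩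
    · exact Or.inr ⟨hy, x, hx, hxy⟩
  | or φ ψ ihφ ihψ =>
    obtain ⟨hPφ, hPψ⟩ := Set.union_subset_iff.1 hP
    obtain ⟨hnφ, hnψ⟩ := max_le_iff.1 hn
    exact hX.imp (ihφ hPφ hnφ · h) (ihψ hPψ hnψ · h)
  | dia φ ih =>
    obtain ⟨n, rfl⟩ := Nat.exists_eq_add_of_le' (Nat.le_trans (Nat.succ_le_succ (Nat.zero_le _)) hn)
    obtain ⟨X', hXX', hX'⟩ := hX
    obtain ⟨Y', hYY', h'⟩ := h.exists_teamR hXX'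
    exact ⟨Y', hYY', ih hP (Nat.le_of_succ_le_succ hn) hX' h'⟩
  | box φ ih =>
    obtain ⟨n, rfl⟩ := Nat.exists_eq_add_of_le' (Nat.le_trans (Nat.succ_le_succ (Nat.zero_le _)) hn)
    exact ih (X := M.img X) (Y := N.img Y) hP (Nat.le_of_succ_le_succ hn) hX h.img

/-- every `FMTL` formula `φ` is invariant under team
bisimulation w.r.t. `L(φ)`, and, if `φ` has modal depth `k`, under team
`k`-bisimulation w.r.t. `L(φ)`. -/
theorem fmtl_bisimulation_invariance {V : Type} (φ : MForm V) :
    (∀ (M N : KModel V) (X : Set M.W) (Y : Set N.W),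
      MSat M X φ → TeamBisim (mletters φ) M X N Y → MSat N Y φ) ∧
    (∀ k : ℕ, mdepth φ = k →
      ∀ (M N : KModel V) (X : Set M.W) (Y : Set N.W),
        MSat M X φ → TeamBisimN (mletters φ) k M X N Y → MSat N Y φ) :=
  ⟨fun _ _ _ _ hX h => hX.of_teamBisimN subset_rfl le_rfl (h.teamBisimN _),
    fun _ hk _ _ _ _ hX h => hX.of_teamBisimN subset_rfl hk.le h⟩
end

section
/- Let P, Q be sets of propositions and let B be a nonempty (P∩Q)-bisimulation between Kripke models M and N. Define the B-amalgamation K of M and N as the Kripke model over propositions P∪Q whose domain is B, with accessibility (m,n) Rᴷ (m',n') iff m Rᴹ m' and n Rᴺ n', and valuation: for r ∈ P, (m,n) ⊨ r iff (M,m) ⊨ r, and for r ∈ Q, (m,n) ⊨ r iff (N,n) ⊨ r. Then the projection onto the first component is a P-bisimulation between K and M, and the projection onto the second component is a Q-bisimulation between K and N. -/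
variable {V : Type}

/-- The `B`-amalgamation `K` of `M` and `N`: its domain is (the graph of)
`B`, its accessibility relation is componentwise, and a letter `r` holds at
`(m,n)` iff `r ∈ P` and `r` holds at `m` in `M`, or `r ∈ Q` and `r` holds at
`n` in `N`. -/
def amalgam (M N : KModel V) (P Q : Set V) (B : M.W → N.W → Prop) : KModel V where
  W := { z : M.W × N.W // B z.1 z.2 }
  R := fun z z' => M.R z.1.1 z'.1.1 ∧ N.R z.1.2 z'.1.2
  val := fun z r => (r ∈ P ∧ M.val z.1.1 r) ∨ (r ∈ Q ∧ N.val z.1.2 r)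

/-- if `B` is a nonempty `(P ∩ Q)`-bisimulation between `M` and
`N`, then, in the `B`-amalgamation `K`, the valuation agrees with `M` on the
letters of `P` and with `N` on the letters of `Q`, the projection onto the
first component is a `P`-bisimulation between `K` and `M`, and the
projection onto the second component is a `Q`-bisimulation between `K` and
`N`. -/
theorem amalgamation {V : Type} (M N : KModel V) (P Q : Set V)
    (B : M.W → N.W → Prop) (hB : IsBisim (P ∩ Q) M N B)
    (hne : ∃ m n, B m n) :
    (∀ z : (amalgam M N P Q B).W, ∀ r ∈ P,
      ((amalgam M N P Q B).val z r ↔ M.val z.1.1 r)) ∧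
    (∀ z : (amalgam M N P Q B).W, ∀ r ∈ Q,
      ((amalgam M N P Q B).val z r ↔ N.val z.1.2 r)) ∧
    IsBisim P (amalgam M N P Q B) M (fun z m => z.1.1 = m) ∧
    IsBisim Q (amalgam M N P Q B) N (fun z n => z.1.2 = n) := by
  obtain ⟨hval, hforth, hback⟩ := hB
  have hP : ∀ z : (amalgam M N P Q B).W, ∀ r ∈ P,
      ((amalgam M N P Q B).val z r ↔ M.val z.1.1 r) := by
    intro z r hr
    refine ⟨?_, fun h => Or.inl ⟨hr, h⟩⟩
    rintro (⟨-, h⟩ | ⟨hrQ, h⟩)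
    · exact h
    · exact (hval _ _ z.2 r ⟨hr, hrQ⟩).2 h
  have hQ : ∀ z : (amalgam M N P Q B).W, ∀ r ∈ Q,
      ((amalgam M N P Q B).val z r ↔ N.val z.1.2 r) := by
    intro z r hr
    refine ⟨?_, fun h => Or.inr ⟨hr, h⟩⟩
    rintro (⟨hrP, h⟩ | ⟨-, h⟩)
    · exact (hval _ _ z.2 r ⟨hrP, hr⟩).1 h
    · exact h
  refine ⟨hP, hQ, ⟨?_, ?_, ?_⟩, ⟨?_, ?_, ?_⟩⟩
  · rintro z _ rfl
    exact hP z
  · rintro z _ rfl z' hz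
    exact ⟨z'.1.1, hz.1, rfl⟩
  · rintro z _ rfl m' hm
    obtain ⟨n', hn, hb⟩ := hforth _ _ z.2 m' hm
    exact ⟨⟨(m', n'), hb⟩, ⟨hm, hn⟩, rfl⟩
  · rintro z _ rfl
    exact hQ z
  · rintro z _ rfl z' hz
    exact ⟨z'.1.2, hz.2, rfl⟩
  · rintro z _ rfl n' hn
    obtain ⟨m', hm, hb⟩ := hback _ _ z.2 n' hn
    exact ⟨⟨(m', n'), hb⟩, ⟨hm, hn⟩, rfl⟩
end

section
/- Suppose θ, φ are classical modal formulas (in ML, the team logic with literals, ⊥, ∧, ⊗, □, ◇) and θ behaves as ∃̃p φ with respect to singleton semantics: for all pointed Kripke models (M,w), (M,w) ⊨ θ iff there exists (N,v) with (N,v) ⇌_{L(φ)∖{p}} (M,w) and (N,v) ⊨ φ. Then θ is equivalent to ∃̃p φ in modal team semantics: for all team models (M,X), (M,X) ⊨ θ iff there exists (N,Y) with (N,Y) ⇌_{L(φ)∖{p}} (M,X) and (N,Y) ⊨ φ. -/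
variable {V : Type}

/-- Classical modal formulas in `ML`: literals, `⊥`, `∧`, `⊗`, `◇`, `□`. -/
inductive MLForm (V : Type) : Type where
  | var : V → MLForm V
  | nvar : V → MLForm V
  | bot : MLForm V
  | and : MLForm V → MLForm V → MLForm V
  | tens : MLForm V → MLForm V → MLForm V
  | dia : MLForm V → MLForm V
  | box : MLForm V → MLForm V

/-- Letters `L(φ)` of an `ML` formula. -/
def mlletters : MLForm V → Set V
  | .var p => {p}
  | .nvar p => {p}
  | .bot => ∅
  | .and φ ψ => mlletters φ ∪ mlletters ψ
  | .tens φ ψ => mlletters φ ∪ mlletters ψ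
  | .dia φ => mlletters φ
  | .box φ => mlletters φ

/-- The classical singleton (pointed) semantics of `ML` formulas, with `⊗`
behaving as ordinary disjunction. -/
def clSat (M : KModel V) : M.W → MLForm V → Prop
  | w, .var p => M.val w p
  | w, .nvar p => ¬ M.val w p
  | _, .bot => False
  | w, .and φ ψ => clSat M w φ ∧ clSat M w ψ
  | w, .tens φ ψ => clSat M w φ ∨ clSat M w ψ
  | w, .dia φ => ∃ v, M.R w v ∧ clSat M v φ
  | w, .box φ => ∀ v, M.R w v → clSat M v φ

/-- Modal team semantics of `ML` formulas. -/
def MLSat (M : KModel V) : Set M.W → MLForm V → Prop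
  | X, .var p => ∀ s ∈ X, M.val s p
  | X, .nvar p => ∀ s ∈ X, ¬ M.val s p
  | X, .bot => X = ∅
  | X, .and φ ψ => MLSat M X φ ∧ MLSat M X ψ
  | X, .tens φ ψ => ∃ X₁ X₂, X = X₁ ∪ X₂ ∧ MLSat M X₁ φ ∧ MLSat M X₂ ψ
  | X, .dia φ => ∃ Y, teamR M X Y ∧ MLSat M Y φ
  | X, .box φ => MLSat M (M.img X) φ

/-- Flatness: a team satisfies an `ML` formula iff each of its points does. -/
theorem MLSat_iff_forall_clSat (M : KModel V) (φ : MLForm V) (X : Set M.W) :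
    MLSat M X φ ↔ ∀ w ∈ X, clSat M w φ := by
  induction φ generalizing X with
  | var q => exact Iff.rfl
  | nvar q => exact Iff.rfl
  | bot => exact Set.eq_empty_iff_forall_notMem
  | and φ ψ ihφ ihψ => simp only [MLSat, clSat, ihφ, ihψ, forall_and]
  | tens φ ψ ihφ ihψ =>
    simp only [MLSat, clSat, ihφ, ihψ]
    constructor
    · rintro ⟨X₁, X₂, rfl, h₁, h₂⟩ w (hw | hw)
      exacts [Or.inl (h₁ w hw), Or.inr (h₂ w hw)]
    · intro h
      refine ⟨{w ∈ X | clSat M w φ}, {w ∈ X | clSat M w ψ}, ?_, fun w hw => hw.2,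
        fun w hw => hw.2⟩
      ext w
      exact ⟨fun hw => (h w hw).imp (⟨hw, ·⟩) (⟨hw, ·⟩), fun hw => hw.elim And.left And.left⟩
  | dia φ ih =>
    simp only [MLSat, clSat, ih]
    constructor
    · rintro ⟨Y, ⟨hXY, -⟩, hY⟩ w hw
      obtain ⟨v, hv, hwv⟩ := hXY w hw
      exact ⟨v, hwv, hY v hv⟩
    · intro h
      refine ⟨{v ∈ M.img X | clSat M v φ}, ⟨fun w hw => ?_, fun v hv => hv.1⟩, fun v hv => hv.2⟩
      obtain ⟨v, hwv, hv⟩ := h w hw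
      exact ⟨v, ⟨⟨w, hw, hwv⟩, hv⟩, hwv⟩
  | box φ ih =>
    simp only [MLSat, clSat, ih]
    exact ⟨fun h w hw v hwv => h v ⟨w, hw, hwv⟩, fun h v ⟨w, hw, hwv⟩ => h w hw v hwv⟩

/-- Bisimilarity is transitive. -/
theorem Bisimilar.trans {P : Set V} {M N K : KModel V} {w : M.W} {v : N.W} {u : K.W}
    (h₁ : Bisimilar P M w N v) (h₂ : Bisimilar P N v K u) : Bisimilar P M w K u := by
  obtain ⟨B, ⟨hval, hforth, hback⟩, hB⟩ := h₁
  obtain ⟨C, ⟨kval, kforth, kback⟩, hC⟩ := h₂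
  refine ⟨fun a c => ∃ b, B a b ∧ C b c, ⟨?_, ?_, ?_⟩, v, hB, hC⟩
  · rintro a c ⟨b, hab, hbc⟩ q hq
    exact (hval a b hab q hq).trans (kval b c hbc q hq)
  · rintro a c ⟨b, hab, hbc⟩ a' ha
    obtain ⟨b', hb, hab'⟩ := hforth a b hab a' ha
    obtain ⟨c', hc, hbc'⟩ := kforth b c hbc b' hb
    exact ⟨c', hc, b', hab', hbc'⟩
  · rintro a c ⟨b, hab, hbc⟩ c' hc
    obtain ⟨b', hb, hbc'⟩ := kback b c hbc c' hc
    obtain ⟨a', ha, hab'⟩ := hback a b hab b' hb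
    exact ⟨a', ha, b', hab', hbc'⟩

/-- Accessibility in a disjoint union of Kripke models. -/
inductive KModel.SigmaRel {ι : Type} (N : ι → KModel V) :
    (Σ i, (N i).W) → (Σ i, (N i).W) → Prop where
  | mk (i : ι) (w v : (N i).W) : (N i).R w v → KModel.SigmaRel N ⟨i, w⟩ ⟨i, v⟩

/-- Disjoint union of a family of Kripke models. -/
def KModel.sigma {ι : Type} (N : ι → KModel V) : KModel V where
  W := Σ i, (N i).W
  R := KModel.SigmaRel N
  val a := (N a.1).val a.2

/-- A point of a component is bisimilar to its copy in the disjoint union. -/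
theorem KModel.bisimilar_sigma {ι : Type} (P : Set V) (N : ι → KModel V) (i : ι) (w : (N i).W) :
    Bisimilar P (KModel.sigma N) ⟨i, w⟩ (N i) w := by
  refine ⟨fun a v => a = ⟨i, v⟩, ⟨?_, ?_, ?_⟩, rfl⟩
  · rintro _ v rfl q -
    exact Iff.rfl
  · rintro _ v rfl _ ⟨_, _, v', hv⟩
    exact ⟨v', hv, rfl⟩
  · rintro _ v rfl v' hv
    exact ⟨⟨i, v'⟩, .mk i v v' hv, rfl⟩

/-- Satisfaction of `ML` formulas is invariant under bisimulations respecting all letters. -/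
theorem IsBisim.clSat_iff {M N : KModel V} {B : M.W → N.W → Prop}
    (hB : IsBisim Set.univ M N B) (φ : MLForm V) {w : M.W} {v : N.W} (hwv : B w v) :
    clSat M w φ ↔ clSat N v φ := by
  obtain ⟨hval, hforth, hback⟩ := hB
  induction φ generalizing w v with
  | var q => exact hval w v hwv q trivial
  | nvar q => exact not_congr (hval w v hwv q trivial)
  | bot => exact Iff.rfl
  | and φ ψ ihφ ihψ => exact and_congr (ihφ hwv) (ihψ hwv)
  | tens φ ψ ihφ ihψ => exact or_congr (ihφ hwv) (ihψ hwv)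
  | dia φ ih =>
    constructor
    · rintro ⟨w', hw, hs⟩
      obtain ⟨v', hv, hb⟩ := hforth w v hwv w' hw
      exact ⟨v', hv, (ih hb).1 hs⟩
    · rintro ⟨v', hv, hs⟩
      obtain ⟨w', hw, hb⟩ := hback w v hwv v' hv
      exact ⟨w', hw, (ih hb).2 hs⟩
  | box φ ih =>
    constructor
    · intro hs v' hv
      obtain ⟨w', hw, hb⟩ := hback w v hwv v' hv
      exact (ih hb).1 (hs w' hw)
    · intro hs w' hw
      obtain ⟨v', hv, hb⟩ := hforth w v hwv w' hw
      exact (ih hb).2 (hs v' hv)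

/-- Satisfaction at a point of a disjoint union is satisfaction in its component. -/
theorem KModel.clSat_sigma {ι : Type} (N : ι → KModel V) (i : ι) (w : (N i).W) (φ : MLForm V) :
    clSat (KModel.sigma N) ⟨i, w⟩ φ ↔ clSat (N i) w φ := by
  obtain ⟨B, hB, hw⟩ := KModel.bisimilar_sigma Set.univ N i w
  exact hB.clSat_iff φ hw

/-- if `θ, φ ∈ ML` and `θ` behaves as `∃̃p φ` w.r.t. singleton
semantics, then `θ` is equivalent to `∃̃p φ` in the modal team semantics. -/
theorem singleton_exq_to_team_exq {V : Type} (θ φ : MLForm V) (p : V)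
    (h : ∀ (M : KModel V) (w : M.W),
      clSat M w θ ↔ ∃ (N : KModel V) (v : N.W),
        Bisimilar (mlletters φ \ {p}) N v M w ∧ clSat N v φ) :
    ∀ (M : KModel V) (X : Set M.W),
      MLSat M X θ ↔ ∃ (N : KModel V) (Y : Set N.W),
        TeamBisim (mlletters φ \ {p}) N Y M X ∧ MLSat N Y φ := by
  intro M X
  simp only [MLSat_iff_forall_clSat]
  constructor
  · intro hX
    choose N v hbis hsat using fun x : X => (h M x).1 (hX x x.2)
    have hcopy (x : X) : Bisimilar (mlletters φ \ {p}) (KModel.sigma N) ⟨x, v x⟩ M x :=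
      (KModel.bisimilar_sigma _ N x (v x)).trans (hbis x)
    refine ⟨KModel.sigma N, Set.range fun x => ⟨x, v x⟩, ⟨?_, ?_⟩, ?_⟩
    · rintro _ ⟨x, rfl⟩
      exact ⟨x, x.2, hcopy x⟩
    · intro x hx
      exact ⟨_, ⟨⟨x, hx⟩, rfl⟩, hcopy ⟨x, hx⟩⟩
    · rintro _ ⟨x, rfl⟩
      exact (KModel.clSat_sigma N x (v x) φ).2 (hsat x)
  · rintro ⟨N, Y, ⟨-, hback⟩, hY⟩ x hx
    obtain ⟨y, hy, hyx⟩ := hback x hx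
    exact (h M x).2 ⟨N, y, hyx, hY y hy⟩
end

section
/- For every classical modal formula φ ∈ ML and propositional letter p, the formula ∃̃p φ is expressible in ML: there exists θ ∈ ML such that for all team models (M,X), (M,X) ⊨ θ iff there exists a team model (N,Y) with (N,Y) ⇌_{L(φ)∖{p}} (M,X) and (N,Y) ⊨ φ. -/
variable {V : Type}

/-! ### Bisimilarity and gluing of models -/

namespace Bisimilar

variable {P : Set V} {M N : KModel V} {w : M.W} {v : N.W}

theorem refl (P : Set V) (M : KModel V) (w : M.W) : Bisimilar P M w M w := by
  refine ⟨Eq, ⟨?_, ?_, ?_⟩, rfl⟩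
  · rintro a _ rfl q _
    exact Iff.rfl
  · rintro a _ rfl b hb
    exact ⟨b, hb, rfl⟩
  · rintro a _ rfl b hb
    exact ⟨b, hb, rfl⟩

theorem val_iff (h : Bisimilar P M w N v) {q : V} (hq : q ∈ P) : M.val w q ↔ N.val v q := by
  obtain ⟨B, hB, hwv⟩ := h
  exact hB.1 w v hwv q hq

theorem forth (h : Bisimilar P M w N v) {w' : M.W} (hw : M.R w w') :
    ∃ v', N.R v v' ∧ Bisimilar P M w' N v' := by
  obtain ⟨B, hB, hwv⟩ := h
  obtain ⟨v', hv, hb⟩ := hB.2.1 w v hwv w' hw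
  exact ⟨v', hv, B, hB, hb⟩

theorem back (h : Bisimilar P M w N v) {v' : N.W} (hv : N.R v v') :
    ∃ w', M.R w w' ∧ Bisimilar P M w' N v' := by
  obtain ⟨B, hB, hwv⟩ := h
  obtain ⟨w', hw, hb⟩ := hB.2.2 w v hwv v' hv
  exact ⟨w', hw, B, hB, hb⟩

end Bisimilar

/-- Accessibility in the glued model: the root `none` sees the distinguished point of every
component. -/
inductive GlueRel {I : Type} (N : I → KModel V) (u : ∀ i, (N i).W) :
    Option (Σ i, (N i).W) → Option (Σ i, (N i).W) → Prop
  | root (i : I) : GlueRel N u none (some ⟨i, u i⟩)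
  | step (i : I) (x y : (N i).W) (h : (N i).R x y) : GlueRel N u (some ⟨i, x⟩) (some ⟨i, y⟩)

/-- The disjoint union of the pointed models `(N i, u i)`, together with a fresh root with
valuation `val₀` that sees every `u i`. -/
def glue {I : Type} (N : I → KModel V) (u : ∀ i, (N i).W) (val₀ : V → Prop) : KModel V where
  W := Option (Σ i, (N i).W)
  R := GlueRel N u
  val a q := match a with
    | none => val₀ q
    | some ⟨i, x⟩ => (N i).val x q

section Glue

variable {I : Type} {N : I → KModel V} {u : ∀ i, (N i).W} {val₀ : V → Prop}

theorem clSat_glue_some {i : I} (x : (N i).W) (φ : MLForm V) :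
    clSat (glue N u val₀) (some ⟨i, x⟩) φ ↔ clSat (N i) x φ := by
  induction φ generalizing x with
  | var q => exact Iff.rfl
  | nvar q => exact Iff.rfl
  | bot => exact Iff.rfl
  | and φ ψ ihφ ihψ => exact and_congr (ihφ x) (ihψ x)
  | tens φ ψ ihφ ihψ => exact or_congr (ihφ x) (ihψ x)
  | dia φ ih =>
    constructor
    · rintro ⟨_, h, hs⟩
      cases h with
      | step _ _ y h => exact ⟨y, h, (ih y).1 hs⟩
    · rintro ⟨y, h, hs⟩
      exact ⟨some ⟨i, y⟩, .step i x y h, (ih y).2 hs⟩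
  | box φ ih =>
    constructor
    · intro H y h
      exact (ih y).1 (H _ (.step i x y h))
    · rintro H _ h
      cases h with
      | step _ _ y h => exact (ih y).2 (H y h)

theorem bisimilar_glue_some {P : Set V} {M : KModel V} {m : M.W} {i : I} {x : (N i).W}
    (h : Bisimilar P (N i) x M m) : Bisimilar P (glue N u val₀) (some ⟨i, x⟩) M m := by
  refine ⟨fun a b => ∃ (j : I) (y : (N j).W), a = some ⟨j, y⟩ ∧ Bisimilar P (N j) y M b,
    ⟨?_, ?_, ?_⟩, i, x, rfl, h⟩
  · rintro _ b ⟨j, y, rfl, hy⟩ q hq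
    exact hy.val_iff hq
  · rintro _ b ⟨j, y, rfl, hy⟩ _ h
    cases h with
    | step _ _ z h =>
      obtain ⟨c, hc, hz⟩ := hy.forth h
      exact ⟨c, hc, j, z, rfl, hz⟩
  · rintro _ b ⟨j, y, rfl, hy⟩ c hc
    obtain ⟨z, h, hz⟩ := hy.back hc
    exact ⟨some ⟨j, z⟩, .step j y z h, j, z, rfl, hz⟩

theorem bisimilar_glue_none {P : Set V} {M : KModel V} {w : M.W}
    (hval : ∀ q ∈ P, (val₀ q ↔ M.val w q))
    (hforth : ∀ i, ∃ m, M.R w m ∧ Bisimilar P (N i) (u i) M m)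
    (hback : ∀ m, M.R w m → ∃ i, Bisimilar P (N i) (u i) M m) :
    Bisimilar P (glue N u val₀) none M w := by
  refine ⟨fun a b => (a = none ∧ b = w) ∨ Bisimilar P (glue N u val₀) a M b,
    ⟨?_, ?_, ?_⟩, Or.inl ⟨rfl, rfl⟩⟩
  · rintro a b (⟨rfl, rfl⟩ | h) q hq
    · exact hval q hq
    · exact h.val_iff hq
  · rintro a b (⟨rfl, rfl⟩ | h) a' ha
    · cases ha with
      | root i =>
        obtain ⟨m, hm, hb⟩ := hforth i
        exact ⟨m, hm, Or.inr (bisimilar_glue_some hb)⟩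
    · obtain ⟨c, hc, hb⟩ := h.forth ha
      exact ⟨c, hc, Or.inr hb⟩
  · rintro a b (⟨rfl, rfl⟩ | h) b' hb
    · obtain ⟨i, hi⟩ := hback b' hb
      exact ⟨some ⟨i, u i⟩, .root i, Or.inr (bisimilar_glue_some hi)⟩
    · obtain ⟨c, hc, hb⟩ := h.back hb
      exact ⟨c, hc, Or.inr hb⟩

end Glue

/-! ### Flatness -/

/-- `ML` formulas are flat: a team satisfies `φ` iff each of its points does. -/
theorem mlSat_iff_forall_clSat (M : KModel V) (φ : MLForm V) (X : Set M.W) :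
    MLSat M X φ ↔ ∀ x ∈ X, clSat M x φ := by
  induction φ generalizing X with
  | var q => exact Iff.rfl
  | nvar q => exact Iff.rfl
  | bot => exact Set.eq_empty_iff_forall_notMem
  | and φ ψ ihφ ihψ =>
    simp only [MLSat, clSat, ihφ, ihψ]
    exact ⟨fun h x hx => ⟨h.1 x hx, h.2 x hx⟩,
      fun h => ⟨fun x hx => (h x hx).1, fun x hx => (h x hx).2⟩⟩
  | tens φ ψ ihφ ihψ =>
    simp only [MLSat, clSat, ihφ, ihψ]
    constructor
    · rintro ⟨X₁, X₂, rfl, h₁, h₂⟩ x (hx | hx)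
      · exact Or.inl (h₁ x hx)
      · exact Or.inr (h₂ x hx)
    · intro h
      refine ⟨{x ∈ X | clSat M x φ}, {x ∈ X | clSat M x ψ}, ?_, fun x hx => hx.2,
        fun x hx => hx.2⟩
      ext x
      constructor
      · intro hx
        exact (h x hx).imp (fun h => ⟨hx, h⟩) (fun h => ⟨hx, h⟩)
      · rintro (hx | hx) <;> exact hx.1
  | dia φ ih =>
    simp only [MLSat, clSat, ih]
    constructor
    · rintro ⟨Y, ⟨h, -⟩, hY⟩ x hx
      obtain ⟨y, hy, hxy⟩ := h x hx
      exact ⟨y, hxy, hY y hy⟩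
    · intro h
      refine ⟨{y | (∃ x ∈ X, M.R x y) ∧ clSat M y φ}, ⟨?_, fun y hy => hy.1⟩, fun y hy => hy.2⟩
      intro x hx
      obtain ⟨y, hxy, hy⟩ := h x hx
      exact ⟨y, ⟨⟨x, hx, hxy⟩, hy⟩, hxy⟩
  | box φ ih =>
    simp only [MLSat, clSat, ih]
    exact ⟨fun h x hx v hv => h v ⟨x, hx, hv⟩, fun h v ⟨x, hx, hv⟩ => h x hx v hv⟩

/-! ### Expressible properties of pointed models -/

/-- A property of pointed models is expressible if some modal formula defines it. -/
def Expressible (Q : ∀ M : KModel V, M.W → Prop) : Prop :=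
  ∃ θ : MLForm V, ∀ (M : KModel V) (w : M.W), clSat M w θ ↔ Q M w

namespace Expressible

variable {Q Q' : ∀ M : KModel V, M.W → Prop}

theorem congr (h : Expressible Q) (hQ : ∀ M w, Q M w ↔ Q' M w) : Expressible Q' := by
  obtain ⟨θ, hθ⟩ := h
  exact ⟨θ, fun M w => (hθ M w).trans (hQ M w)⟩

theorem false : Expressible fun (M : KModel V) (_ : M.W) => False :=
  ⟨.bot, fun _ _ => Iff.rfl⟩

theorem true [Nonempty V] : Expressible fun (M : KModel V) (_ : M.W) => True := by
  obtain ⟨p⟩ := ‹Nonempty V›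
  exact ⟨.tens (.var p) (.nvar p), fun M w => iff_true_intro (Classical.em _)⟩

theorem and (h : Expressible Q) (h' : Expressible Q') :
    Expressible fun M w => Q M w ∧ Q' M w := by
  obtain ⟨θ, hθ⟩ := h
  obtain ⟨θ', hθ'⟩ := h'
  exact ⟨.and θ θ', fun M w => and_congr (hθ M w) (hθ' M w)⟩

theorem or (h : Expressible Q) (h' : Expressible Q') :
    Expressible fun M w => Q M w ∨ Q' M w := by
  obtain ⟨θ, hθ⟩ := h
  obtain ⟨θ', hθ'⟩ := h'
  exact ⟨.tens θ θ', fun M w => or_congr (hθ M w) (hθ' M w)⟩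

theorem dia (h : Expressible Q) : Expressible fun M w => ∃ v, M.R w v ∧ Q M v := by
  obtain ⟨θ, hθ⟩ := h
  exact ⟨.dia θ, fun M w => exists_congr fun v => and_congr_right fun _ => hθ M v⟩

theorem box (h : Expressible Q) : Expressible fun M w => ∀ v, M.R w v → Q M v := by
  obtain ⟨θ, hθ⟩ := h
  exact ⟨.box θ, fun M w => forall_congr' fun v => imp_congr_right fun _ => hθ M v⟩

variable {α : Type} {T : α → ∀ M : KModel V, M.W → Prop}

theorem list_forall [Nonempty V] (l : List α) (h : ∀ a ∈ l, Expressible (T a)) :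
    Expressible fun M w => ∀ a ∈ l, T a M w := by
  induction l with
  | nil => exact true.congr fun M w => by simp
  | cons a l ih =>
    rw [List.forall_mem_cons] at h
    exact (h.1.and (ih h.2)).congr fun M w => by
      rw [List.forall_mem_cons]

theorem list_exists (l : List α) (h : ∀ a ∈ l, Expressible (T a)) :
    Expressible fun M w => ∃ a ∈ l, T a M w := by
  induction l with
  | nil => exact false.congr fun M w => by simp
  | cons a l ih =>
    rw [List.forall_mem_cons] at h
    exact (h.1.or (ih h.2)).congr fun M w => by simp

end Expressible

/-! ### Disjunctive normal forms -/

namespace MLForm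

/-- Modal depth. -/
def depth : MLForm V → ℕ
  | .var _ => 0
  | .nvar _ => 0
  | .bot => 0
  | .and φ ψ => max φ.depth ψ.depth
  | .tens φ ψ => max φ.depth ψ.depth
  | .dia φ => φ.depth + 1
  | .box φ => φ.depth + 1

/-- Literals over `S`, and formulas `◇ψ`, `□ψ` with `ψ` over `S` of modal depth `< n`. -/
def IsBasic (S : Set V) (n : ℕ) : MLForm V → Prop
  | .var q => q ∈ S
  | .nvar q => q ∈ S
  | .dia ψ => ψ.depth < n ∧ mlletters ψ ⊆ S
  | .box ψ => ψ.depth < n ∧ mlletters ψ ⊆ S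
  | _ => False

end MLForm

/-- `Γ` holds at `w`: all members of the list `Γ` do. -/
def AllSat (Γ : List (MLForm V)) (M : KModel V) (w : M.W) : Prop := ∀ χ ∈ Γ, clSat M w χ

/-- `Q` is defined by a finite disjunction of finite conjunctions of basic formulas. -/
def HasDNF (S : Set V) (n : ℕ) (Q : ∀ M : KModel V, M.W → Prop) : Prop :=
  ∃ L : List (List (MLForm V)), (∀ C ∈ L, ∀ χ ∈ C, χ.IsBasic S n) ∧
    ∀ (M : KModel V) (w : M.W), Q M w ↔ ∃ C ∈ L, AllSat C M w

namespace HasDNF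

variable {S : Set V} {n : ℕ} {Q Q' : ∀ M : KModel V, M.W → Prop}

theorem of_isBasic {χ : MLForm V} (h : χ.IsBasic S n) : HasDNF S n fun M w => clSat M w χ :=
  ⟨[[χ]], by simpa using h, fun M w => by simp [AllSat]⟩

theorem or (h : HasDNF S n Q) (h' : HasDNF S n Q') : HasDNF S n fun M w => Q M w ∨ Q' M w := by
  obtain ⟨L, hL, hQ⟩ := h
  obtain ⟨L', hL', hQ'⟩ := h'
  refine ⟨L ++ L', fun C hC => ?_, fun M w => ?_⟩
  · exact (List.mem_append.1 hC).elim (hL C) (hL' C)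
  · simp only [hQ, hQ', List.mem_append, or_and_right, exists_or]

theorem and (h : HasDNF S n Q) (h' : HasDNF S n Q') : HasDNF S n fun M w => Q M w ∧ Q' M w := by
  obtain ⟨L, hL, hQ⟩ := h
  obtain ⟨L', hL', hQ'⟩ := h'
  refine ⟨L.flatMap fun C => L'.map fun C' => C ++ C', fun D hD χ hχ => ?_, fun M w => ?_⟩
  · obtain ⟨C, hC, hD⟩ := List.mem_flatMap.1 hD
    obtain ⟨C', hC', rfl⟩ := List.mem_map.1 hD
    exact (List.mem_append.1 hχ).elim (hL C hC χ) (hL' C' hC' χ)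
  · simp only [hQ, hQ']
    constructor
    · rintro ⟨⟨C, hC, h⟩, C', hC', h'⟩
      exact ⟨C ++ C', List.mem_flatMap.2 ⟨C, hC, List.mem_map.2 ⟨C', hC', rfl⟩⟩,
        fun χ hχ => (List.mem_append.1 hχ).elim (h χ) (h' χ)⟩
    · rintro ⟨D, hD, h⟩
      obtain ⟨C, hC, hD⟩ := List.mem_flatMap.1 hD
      obtain ⟨C', hC', rfl⟩ := List.mem_map.1 hD
      exact ⟨⟨C, hC, fun χ hχ => h χ (List.mem_append_left _ hχ)⟩,
        C', hC', fun χ hχ => h χ (List.mem_append_right _ hχ)⟩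

theorem clSat {φ : MLForm V} (hd : φ.depth ≤ n) (hS : mlletters φ ⊆ S) :
    HasDNF S n fun M w => clSat M w φ := by
  induction φ with
  | var q => exact of_isBasic (hS rfl)
  | nvar q => exact of_isBasic (hS rfl)
  | bot => exact ⟨[], by simp, fun M w => by simp [_root_.clSat]⟩
  | and φ ψ ihφ ihψ =>
    exact (ihφ (le_trans (le_max_left _ _) hd) (Set.union_subset_iff.1 hS).1).and
      (ihψ (le_trans (le_max_right _ _) hd) (Set.union_subset_iff.1 hS).2)
  | tens φ ψ ihφ ihψ =>
    exact (ihφ (le_trans (le_max_left _ _) hd) (Set.union_subset_iff.1 hS).1).or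
      (ihψ (le_trans (le_max_right _ _) hd) (Set.union_subset_iff.1 hS).2)
  | dia φ _ => exact of_isBasic ⟨hd, hS⟩
  | box φ _ => exact of_isBasic ⟨hd, hS⟩

theorem allSat {Γ : List (MLForm V)} (h : ∀ χ ∈ Γ, χ.depth ≤ n ∧ mlletters χ ⊆ S) :
    HasDNF S n (AllSat Γ) := by
  induction Γ with
  | nil => exact ⟨[[]], by simp, fun M w => by simp [AllSat]⟩
  | cons φ Γ ih =>
    rw [List.forall_mem_cons] at h
    obtain ⟨L, hL, hQ⟩ := (clSat h.1.1 h.1.2).and (ih h.2)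
    exact ⟨L, hL, fun M w => List.forall_mem_cons.trans (hQ M w)⟩

end HasDNF

/-! ### Elimination of the bisimulation quantifier on pointed models -/

/-- Some pointed model `P`-bisimilar to `(M, w)` has the property `Q`. -/
def ExBisim (P : Set V) (Q : ∀ M : KModel V, M.W → Prop) (M : KModel V) (w : M.W) : Prop :=
  ∃ (N : KModel V) (v : N.W), Bisimilar P N v M w ∧ Q N v

/-- The list of all `ψ` with `□ψ ∈ C`. -/
def boxBodies (C : List (MLForm V)) : List (MLForm V) :=
  C.filterMap fun χ => match χ with
    | .box ψ => some ψ
    | _ => none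

theorem mem_boxBodies {C : List (MLForm V)} {ψ : MLForm V} : ψ ∈ boxBodies C ↔ .box ψ ∈ C := by
  rw [boxBodies, List.mem_filterMap]
  constructor
  · rintro ⟨χ, hχ, h⟩
    cases χ <;> simp_all
  · exact fun h => ⟨_, h, rfl⟩

/-- The condition that a basic conjunct `χ` of a clause with box bodies `B` imposes on `(M, w)`
once `p` is quantified away. -/
def QuantifiedConjunct (P : Set V) (p : V) (B : List (MLForm V)) :
    MLForm V → ∀ M : KModel V, M.W → Prop
  | .var q, M, w => q ≠ p → M.val w q
  | .nvar q, M, w => q ≠ p → ¬ M.val w q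
  | .dia ψ, M, w => ∃ v, M.R w v ∧ ExBisim P (AllSat (ψ :: B)) M v
  | _, _, _ => True

section Elimination

variable {P S : Set V} {p : V} {n : ℕ} {C : List (MLForm V)}

/-- A consistent clause holds in some `P`-bisimilar copy of `(M, w)` iff the quantified conjuncts
hold at `w` and the box bodies hold in `P`-bisimilar copies of all successors of `w`. -/
theorem exBisim_allSat_iff (hP : p ∉ P) (hS : ∀ q ∈ S, q ≠ p → q ∈ P)
    (hC : ∀ χ ∈ C, χ.IsBasic S n) (hp : ¬ (.var p ∈ C ∧ .nvar p ∈ C))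
    (M : KModel V) (w : M.W) :
    ExBisim P (AllSat C) M w ↔
      (∀ v, M.R w v → ExBisim P (AllSat (boxBodies C)) M v) ∧
        ∀ χ ∈ C, QuantifiedConjunct P p (boxBodies C) χ M w := by
  constructor
  · rintro ⟨N, v, hNM, hsat⟩
    have hbox : ∀ v', N.R v v' → AllSat (boxBodies C) N v' := fun v' hv β hβ =>
      hsat _ (mem_boxBodies.1 hβ) v' hv
    refine ⟨fun w' hw => ?_, fun χ hχ => ?_⟩
    · obtain ⟨v', hv, hb⟩ := hNM.back hw
      exact ⟨N, v', hb, hbox v' hv⟩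
    · have hs := hsat χ hχ
      have hbasic := hC χ hχ
      cases χ with
      | var q => exact fun hq => (hNM.val_iff (hS q hbasic hq)).1 hs
      | nvar q => exact fun hq h => hs ((hNM.val_iff (hS q hbasic hq)).2 h)
      | dia ψ =>
        obtain ⟨v', hv, hψ⟩ := hs
        obtain ⟨w', hw, hb⟩ := hNM.forth hv
        exact ⟨w', hw, N, v', hb, List.forall_mem_cons.2 ⟨hψ, hbox v' hv⟩⟩
      | _ => trivial
  · rintro ⟨hsucc, hconj⟩
    have hdia : ∀ d : {ψ : MLForm V // .dia ψ ∈ C},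
        ∃ v, M.R w v ∧ ExBisim P (AllSat (d.1 :: boxBodies C)) M v := fun d => hconj _ d.2
    choose m hm Nd ud hud hsatd using hdia
    have hsucc' : ∀ v : {v // M.R w v}, ExBisim P (AllSat (boxBodies C)) M v :=
      fun v => hsucc v.1 v.2
    choose Ns us hus hsats using hsucc'
    let N : {v // M.R w v} ⊕ {ψ : MLForm V // .dia ψ ∈ C} → KModel V := Sum.elim Ns Nd
    let u : ∀ i, (N i).W := fun i => match i with
      | .inl v => us v
      | .inr d => ud d
    let val₀ : V → Prop := fun q => (q = p ∧ .var p ∈ C) ∨ (q ≠ p ∧ M.val w q)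
    have hB : ∀ i, AllSat (boxBodies C) (N i) (u i) := by
      rintro (v | d)
      · exact hsats v
      · exact (List.forall_mem_cons.1 (hsatd d)).2
    refine ⟨glue N u val₀, none, bisimilar_glue_none ?_ ?_ ?_, fun χ hχ => ?_⟩
    · intro q hq
      have hqp : q ≠ p := fun h => hP (h ▸ hq)
      simp [val₀, hqp]
    · rintro (v | d)
      · exact ⟨v.1, v.2, hus v⟩
      · exact ⟨m d, hm d, hud d⟩
    · exact fun v hv => ⟨.inl ⟨v, hv⟩, hus ⟨v, hv⟩⟩
    · have hq := hconj χ hχ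
      have hbasic := hC χ hχ
      cases χ with
      | var q =>
        by_cases h : q = p
        · exact Or.inl ⟨h, h ▸ hχ⟩
        · exact Or.inr ⟨h, hq h⟩
      | nvar q =>
        rintro (⟨rfl, h⟩ | ⟨h, hv⟩)
        · exact hp ⟨h, hχ⟩
        · exact hq h hv
      | dia ψ =>
        exact ⟨some ⟨.inr ⟨ψ, hχ⟩, u (.inr ⟨ψ, hχ⟩)⟩, .root _,
          (clSat_glue_some _ _).2 (List.forall_mem_cons.1 (hsatd ⟨ψ, hχ⟩)).1⟩
      | box ψ =>
        intro _ h
        cases h with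
        | root i => exact (clSat_glue_some _ _).2 (hB i ψ (mem_boxBodies.2 hχ))
      | bot => exact hbasic.elim
      | and => exact hbasic.elim
      | tens => exact hbasic.elim

theorem expressible_exBisim_of_isBasic (hP : p ∉ P) (hS : ∀ q ∈ S, q ≠ p → q ∈ P)
    (hC : ∀ χ ∈ C, χ.IsBasic S n)
    (ih : ∀ Γ : List (MLForm V), (∀ χ ∈ Γ, χ.depth < n ∧ mlletters χ ⊆ S) →
      Expressible (ExBisim P (AllSat Γ))) :
    Expressible (ExBisim P (AllSat C)) := by
  have : Nonempty V := ⟨p⟩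
  by_cases hp : .var p ∈ C ∧ .nvar p ∈ C
  · refine Expressible.false.congr fun M w => ⟨False.elim, ?_⟩
    rintro ⟨N, v, -, h⟩
    exact h _ hp.2 (h _ hp.1)
  have hB : ∀ β ∈ boxBodies C, β.depth < n ∧ mlletters β ⊆ S :=
    fun β hβ => hC _ (mem_boxBodies.1 hβ)
  refine ((ih _ hB).box.and (Expressible.list_forall C fun χ hχ => ?_)).congr
    fun M w => (exBisim_allSat_iff hP hS hC hp M w).symm
  have hbasic := hC χ hχ
  cases χ with
  | var q =>
    by_cases h : q = p
    · exact Expressible.true.congr fun M w => by simp [QuantifiedConjunct, h]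
    · exact ⟨.var q, fun M w => by simp [QuantifiedConjunct, h, clSat]⟩
  | nvar q =>
    by_cases h : q = p
    · exact Expressible.true.congr fun M w => by simp [QuantifiedConjunct, h]
    · exact ⟨.nvar q, fun M w => by simp [QuantifiedConjunct, h, clSat]⟩
  | dia ψ => exact (ih _ (List.forall_mem_cons.2 ⟨hbasic, hB⟩)).dia
  | _ => exact Expressible.true

theorem expressible_exBisim_allSat (hP : p ∉ P) (hS : ∀ q ∈ S, q ≠ p → q ∈ P)
    (Γ : List (MLForm V)) (hΓ : ∀ χ ∈ Γ, χ.depth < n ∧ mlletters χ ⊆ S) :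
    Expressible (ExBisim P (AllSat Γ)) := by
  have : Nonempty V := ⟨p⟩
  induction n generalizing Γ with
  | zero =>
    have hnil : Γ = [] := List.eq_nil_iff_forall_not_mem.2 fun χ hχ => by
      simpa using (hΓ χ hχ).1
    subst hnil
    exact Expressible.true.congr fun M w =>
      ⟨fun _ => ⟨M, w, .refl P M w, by simp [AllSat]⟩, fun _ => trivial⟩
  | succ n ih =>
    obtain ⟨L, hL, hQ⟩ := HasDNF.allSat fun χ hχ => ⟨Nat.lt_succ_iff.1 (hΓ χ hχ).1, (hΓ χ hχ).2⟩
    refine (Expressible.list_exists L fun C hC =>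
      expressible_exBisim_of_isBasic hP hS (hL C hC) ih).congr fun M w => ?_
    simp only [ExBisim, hQ]
    constructor
    · rintro ⟨C, hC, N, v, hb, hs⟩
      exact ⟨N, v, hb, C, hC, hs⟩
    · rintro ⟨N, v, hb, C, hC, hs⟩
      exact ⟨C, hC, N, v, hb, hs⟩

end Elimination

/-- On teams, the bisimulation quantifier acts pointwise on a modal formula. -/
theorem exists_teamBisim_mlSat_iff (P : Set V) (φ : MLForm V) (M : KModel V) (X : Set M.W) :
    (∃ (N : KModel V) (Y : Set N.W), TeamBisim P N Y M X ∧ MLSat N Y φ) ↔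
      ∀ x ∈ X, ExBisim P (fun N v => clSat N v φ) M x := by
  constructor
  · rintro ⟨N, Y, hb, hs⟩ x hx
    obtain ⟨y, hy, hyx⟩ := hb.2 x hx
    exact ⟨N, y, hyx, (mlSat_iff_forall_clSat N φ Y).1 hs y hy⟩
  · intro h
    have h' : ∀ x : X, ExBisim P (fun N v => clSat N v φ) M x := fun x => h x.1 x.2
    choose N u hb hs using h'
    refine ⟨glue N u fun _ => False, Set.range fun x => some ⟨x, u x⟩, ⟨?_, ?_⟩, ?_⟩
    · rintro _ ⟨x, rfl⟩
      exact ⟨x.1, x.2, bisimilar_glue_some (hb x)⟩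
    · exact fun x hx => ⟨_, ⟨⟨x, hx⟩, rfl⟩, bisimilar_glue_some (hb ⟨x, hx⟩)⟩
    · rw [mlSat_iff_forall_clSat]
      rintro _ ⟨x, rfl⟩
      exact (clSat_glue_some _ _).2 (hs x)

/-- for every `φ ∈ ML` and letter `p`, the formula `∃̃p φ` is
expressible in `ML`. -/
theorem ml_exq_elimination {V : Type} (φ : MLForm V) (p : V) :
    ∃ θ : MLForm V, ∀ (M : KModel V) (X : Set M.W),
      MLSat M X θ ↔ ∃ (N : KModel V) (Y : Set N.W),
        TeamBisim (mlletters φ \ {p}) N Y M X ∧ MLSat N Y φ := by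
  obtain ⟨θ, hθ⟩ := expressible_exBisim_allSat (P := mlletters φ \ {p}) (S := mlletters φ)
    (n := φ.depth + 1)
    (fun h => h.2 rfl) (fun q hq hqp => ⟨hq, hqp⟩) [φ]
    (by simp)
  refine ⟨θ, fun M X => ?_⟩
  rw [mlSat_iff_forall_clSat, exists_teamBisim_mlSat_iff]
  simp only [hθ, ExBisim, AllSat, List.forall_mem_singleton]
end
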